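/- Let 0 < ε < 1 and let v = (v₁, v₂, v₃) ∈ ℂ³ satisfy ‖v‖ = 1 and |v₂|² + |v₃|² = ε (so |v₁|² = 1 − ε). Set δ = √(ε(1−ε)), and define Z₁(v) = [[1, 0, 0], [0, v̄₁v₂/δ, −v₁v̄₃/δ], [0, v̄₁v₃/δ, v₁v̄₂/δ]] and Z₂(v) = [[v̄₁v₂/δ, −v₁v̄₃/δ, 0], [v̄₁v₃/δ, v₁v̄₂/δ, 0], [0, 0, 1]]. Then Z₁(v) and Z₂(v) are special unitary: they lie in SU(3), i.e. they are unitary with determinant 1. -/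

import Mathlib

open Matrix

noncomputable section

/-- Euclidean space `ℂ³`. -/
abbrev E3 := EuclideanSpace ℂ (Fin 3)

/-- `δ = √(ε(1−ε))` viewed as a complex number. -/
def δc (ε : ℝ) : ℂ := ((Real.sqrt (ε * (1 - ε)) : ℝ) : ℂ)

/-- The matrix `Z₁(v)`. -/
def Z1 (ε : ℝ) (v : E3) : Matrix (Fin 3) (Fin 3) ℂ :=
  !![1, 0, 0;
     0, (starRingEnd ℂ) (v 0) * v 1 / δc ε, -(v 0 * (starRingEnd ℂ) (v 2)) / δc ε;
     0, (starRingEnd ℂ) (v 0) * v 2 / δc ε, v 0 * (starRingEnd ℂ) (v 1) / δc ε]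

/-- The matrix `Z₂(v)`. -/
def Z2 (ε : ℝ) (v : E3) : Matrix (Fin 3) (Fin 3) ℂ :=
  !![(starRingEnd ℂ) (v 0) * v 1 / δc ε, -(v 0 * (starRingEnd ℂ) (v 2)) / δc ε, 0;
     (starRingEnd ℂ) (v 0) * v 2 / δc ε, v 0 * (starRingEnd ℂ) (v 1) / δc ε, 0;
     0, 0, 1]

/-- The block sum of `1` and a quaternionic `2 × 2` block of norm `1` is special unitary. -/
theorem one_block_mem_specialUnitaryGroup {a b : ℂ}
    (h : a * (starRingEnd ℂ) a + b * (starRingEnd ℂ) b = 1) :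
    !![1, 0, 0; 0, a, -(starRingEnd ℂ) b; 0, b, (starRingEnd ℂ) a] ∈
      Matrix.specialUnitaryGroup (Fin 3) ℂ := by
  rw [Matrix.mem_specialUnitaryGroup_iff, Matrix.mem_unitaryGroup_iff]
  constructor
  · ext i j
    fin_cases i <;> fin_cases j <;>
      simp [Matrix.mul_apply, Fin.sum_univ_three, Matrix.star_apply] <;>
      first | ring1 | linear_combination h
  · simp [Matrix.det_fin_three]
    linear_combination h

/-- The block sum of a quaternionic `2 × 2` block of norm `1` and `1` is special unitary. -/
theorem block_one_mem_specialUnitaryGroup {a b : ℂ}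
    (h : a * (starRingEnd ℂ) a + b * (starRingEnd ℂ) b = 1) :
    !![a, -(starRingEnd ℂ) b, 0; b, (starRingEnd ℂ) a, 0; 0, 0, 1] ∈
      Matrix.specialUnitaryGroup (Fin 3) ℂ := by
  rw [Matrix.mem_specialUnitaryGroup_iff, Matrix.mem_unitaryGroup_iff]
  constructor
  · ext i j
    fin_cases i <;> fin_cases j <;>
      simp [Matrix.mul_apply, Fin.sum_univ_three, Matrix.star_apply] <;>
      first | ring1 | linear_combination h
  · simp [Matrix.det_fin_three]
    linear_combination h

theorem conj_δc (ε : ℝ) : (starRingEnd ℂ) (δc ε) = δc ε :=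
  Complex.conj_ofReal _

theorem δc_sq {ε : ℝ} (h : 0 ≤ ε * (1 - ε)) : δc ε ^ 2 = ε * (1 - ε) := by
  rw [δc, ← Complex.ofReal_pow, Real.sq_sqrt h]
  push_cast
  rfl

theorem Z1_eq (ε : ℝ) (v : E3) {a b : ℂ} (ha : a = (starRingEnd ℂ) (v 0) * v 1 / δc ε)
    (hb : b = (starRingEnd ℂ) (v 0) * v 2 / δc ε) :
    Z1 ε v = !![1, 0, 0; 0, a, -(starRingEnd ℂ) b; 0, b, (starRingEnd ℂ) a] := by
  simp [Z1, ha, hb, conj_δc, neg_div]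

theorem Z2_eq (ε : ℝ) (v : E3) {a b : ℂ} (ha : a = (starRingEnd ℂ) (v 0) * v 1 / δc ε)
    (hb : b = (starRingEnd ℂ) (v 0) * v 2 / δc ε) :
    Z2 ε v = !![a, -(starRingEnd ℂ) b, 0; b, (starRingEnd ℂ) a, 0; 0, 0, 1] := by
  simp [Z2, ha, hb, conj_δc, neg_div]

/-- The transition matrices `Z₁(v)` and `Z₂(v)` lie in `SU(3)`: they are unitary with
determinant 1. -/
theorem Z1_Z2_mem_SU3 (ε : ℝ) (hε0 : 0 < ε) (hε1 : ε < 1) (v : E3) (hv : ‖v‖ = 1)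
    (hve : ‖v 1‖ ^ 2 + ‖v 2‖ ^ 2 = ε) :
    Z1 ε v ∈ Matrix.unitaryGroup (Fin 3) ℂ ∧ (Z1 ε v).det = 1 ∧
    Z2 ε v ∈ Matrix.unitaryGroup (Fin 3) ℂ ∧ (Z2 ε v).det = 1 := by
  have hpos : 0 < ε * (1 - ε) := mul_pos hε0 (sub_pos.mpr hε1)
  have hδ2 : δc ε ^ 2 = ε * (1 - ε) := δc_sq hpos.le
  have hδ : δc ε ^ 2 ≠ 0 := by
    rw [hδ2]
    exact_mod_cast hpos.ne'
  have hv0 : ‖v 0‖ ^ 2 = 1 - ε := by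
    have h := EuclideanSpace.norm_sq_eq v
    rw [hv, Fin.sum_univ_three] at h
    linarith
  have hc0 : v 0 * (starRingEnd ℂ) (v 0) = 1 - ε := by
    rw [Complex.mul_conj', ← Complex.ofReal_pow, hv0, Complex.ofReal_sub, Complex.ofReal_one]
  have hc12 : v 1 * (starRingEnd ℂ) (v 1) + v 2 * (starRingEnd ℂ) (v 2) = ε := by
    rw [Complex.mul_conj', Complex.mul_conj', ← Complex.ofReal_pow,
      ← Complex.ofReal_pow, ← Complex.ofReal_add, hve]
  obtain ⟨a, ha⟩ : ∃ a, a = (starRingEnd ℂ) (v 0) * v 1 / δc ε := ⟨_, rfl⟩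
  obtain ⟨b, hb⟩ : ∃ b, b = (starRingEnd ℂ) (v 0) * v 2 / δc ε := ⟨_, rfl⟩
  have hab : a * (starRingEnd ℂ) a + b * (starRingEnd ℂ) b = 1 := by
    calc
      _ = v 0 * (starRingEnd ℂ) (v 0) *
          (v 1 * (starRingEnd ℂ) (v 1) + v 2 * (starRingEnd ℂ) (v 2)) / δc ε ^ 2 := by
        simp only [ha, hb, map_div₀, map_mul, Complex.conj_conj, conj_δc]
        ring
      _ = 1 := by
        rw [hc0, hc12, mul_comm, ← hδ2, div_self hδ]
  have h1 := Matrix.mem_specialUnitaryGroup_iff.mp (one_block_mem_specialUnitaryGroup hab)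
  have h2 := Matrix.mem_specialUnitaryGroup_iff.mp (block_one_mem_specialUnitaryGroup hab)
  rw [Z1_eq ε v ha hb, Z2_eq ε v ha hb]
  exact ⟨h1.1, h1.2, h2.1, h2.2⟩
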